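/- Let 0 ≤ α < ω₁ and let X be a topological space. Then any two disjoint sets A and B of the α'th functionally multiplicative class in X are α-separated, i.e. there exists f ∈ K_α(X) with A ⊆ f⁻¹(0) and B ⊆ f⁻¹(1). -/

import Mathlib

open Set

universe u v

/-- `A` is functionally open in `X`: `A = f⁻¹((0,1])` for some continuous `f : X → [0,1]`. -/
def FunctionallyOpen (X : Type u) [TopologicalSpace X] (A : Set X) : Prop :=
  ∃ f : X → ℝ, Continuous f ∧ (∀ x, f x ∈ Set.Icc (0:ℝ) 1) ∧ A = f ⁻¹' (Set.Ioc 0 1)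

/-- `A` is functionally closed in `X`: `A = f⁻¹(0)` for some continuous `f : X → [0,1]`. -/
def FunctionallyClosed (X : Type u) [TopologicalSpace X] (A : Set X) : Prop :=
  ∃ f : X → ℝ, Continuous f ∧ (∀ x, f x ∈ Set.Icc (0:ℝ) 1) ∧ A = f ⁻¹' {0}

mutual
/-- The `α`'th functionally additive class in `X`. -/
inductive FunAdd (X : Type u) [TopologicalSpace X] : Ordinal.{0} → Set X → Prop where
  | base (A : Set X) : FunctionallyOpen X A → FunAdd X 0 A
  | union (α : Ordinal.{0}) (hα : α ≠ 0) (β : ℕ → Ordinal.{0}) (hβ : ∀ n, β n < α)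
      (s : ℕ → Set X) (hs : ∀ n, FunMul X (β n) (s n)) : FunAdd X α (⋃ n, s n)

/-- The `α`'th functionally multiplicative class in `X`. -/
inductive FunMul (X : Type u) [TopologicalSpace X] : Ordinal.{0} → Set X → Prop where
  | base (A : Set X) : FunctionallyClosed X A → FunMul X 0 A
  | inter (α : Ordinal.{0}) (hα : α ≠ 0) (β : ℕ → Ordinal.{0}) (hβ : ∀ n, β n < α)
      (s : ℕ → Set X) (hs : ∀ n, FunAdd X (β n) (s n)) : FunMul X α (⋂ n, s n)
end

mutual
/-- The `α`'th (ordinary) additive Borel class in `X`. -/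
inductive BorelAdd (X : Type u) [TopologicalSpace X] : Ordinal.{0} → Set X → Prop where
  | base (A : Set X) : IsOpen A → BorelAdd X 0 A
  | union (α : Ordinal.{0}) (hα : α ≠ 0) (β : ℕ → Ordinal.{0}) (hβ : ∀ n, β n < α)
      (s : ℕ → Set X) (hs : ∀ n, BorelMul X (β n) (s n)) : BorelAdd X α (⋃ n, s n)

/-- The `α`'th (ordinary) multiplicative Borel class in `X`. -/
inductive BorelMul (X : Type u) [TopologicalSpace X] : Ordinal.{0} → Set X → Prop where
  | base (A : Set X) : IsClosed A → BorelMul X 0 A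
  | inter (α : Ordinal.{0}) (hα : α ≠ 0) (β : ℕ → Ordinal.{0}) (hβ : ∀ n, β n < α)
      (s : ℕ → Set X) (hs : ∀ n, BorelAdd X (β n) (s n)) : BorelMul X α (⋂ n, s n)
end

/-- A set is functionally ambiguous of class `α` if it belongs to both the `α`'th functionally
additive and the `α`'th functionally multiplicative class. -/
def FunAmbiguous (X : Type u) [TopologicalSpace X] (α : Ordinal.{0}) (A : Set X) : Prop :=
  FunAdd X α A ∧ FunMul X α A

/-- `f ∈ K_α(X,Y)`: for `α = 0` continuity, for `α > 0` preimages of open sets belong to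
the `α`'th functionally additive class. -/
def KClass {X : Type u} {Y : Type v} [TopologicalSpace X] [TopologicalSpace Y]
    (α : Ordinal.{0}) (f : X → Y) : Prop :=
  (α = 0 → Continuous f) ∧ (α ≠ 0 → ∀ V : Set Y, IsOpen V → FunAdd X α (f ⁻¹' V))

/-- `A` and `B` are `α`-separated in `X`. -/
def AlphaSeparated {X : Type u} [TopologicalSpace X] (α : Ordinal.{0}) (A B : Set X) : Prop :=
  ∃ f : X → ℝ, KClass α f ∧ A ⊆ f ⁻¹' {0} ∧ B ⊆ f ⁻¹' {1}

/-- `X` is an `α`-separated space: any two disjoint sets of the `α`'th (ordinary)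
multiplicative class are `α`-separated. -/
def AlphaSeparatedSpace (X : Type u) [TopologicalSpace X] (α : Ordinal.{0}) : Prop :=
  ∀ A B : Set X, BorelMul X α A → BorelMul X α B → Disjoint A B → AlphaSeparated α A B

/-- `E` is `α`-embedded in `X`. -/
def AlphaEmbedded {X : Type u} [TopologicalSpace X] (α : Ordinal.{0}) (E : Set X) : Prop :=
  (∀ A : Set ↥E, FunAdd ↥E α A → ∃ B : Set X, FunAdd X α B ∧ Subtype.val '' A = B ∩ E) ∧
  (∀ A : Set ↥E, FunMul ↥E α A → ∃ B : Set X, FunMul X α B ∧ Subtype.val '' A = B ∩ E)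

/-- `E` is ambiguously `α`-embedded in `X`. -/
def AmbiguouslyEmbedded {X : Type u} [TopologicalSpace X] (α : Ordinal.{0}) (E : Set X) : Prop :=
  ∀ A : Set ↥E, FunAmbiguous ↥E α A →
    ∃ B : Set X, FunAmbiguous X α B ∧ Subtype.val '' A = B ∩ E

/-- The first uncountable ordinal. -/
noncomputable def omega1 : Ordinal.{0} := (Cardinal.aleph 1).ord

/-- `A` is an `F_σ`-set: a countable union of closed sets. -/
def IsFSigma {X : Type u} [TopologicalSpace X] (A : Set X) : Prop :=
  ∃ F : ℕ → Set X, (∀ n, IsClosed (F n)) ∧ A = ⋃ n, F n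

/-- A space has a countable π-base. -/
def CountablePiBase (Z : Type v) [TopologicalSpace Z] : Prop :=
  ∃ 𝒰 : Set (Set Z), 𝒰.Countable ∧ (∀ U ∈ 𝒰, IsOpen U ∧ U.Nonempty) ∧
    ∀ V : Set Z, IsOpen V → V.Nonempty → ∃ U ∈ 𝒰, U ⊆ V

section helpers

variable {X : Type u} [TopologicalSpace X]

theorem h3_compl (α : Ordinal.{0}) : ∀ A : Set X,
    (FunAdd X α A → FunMul X α Aᶜ) ∧ (FunMul X α A → FunAdd X α Aᶜ) := by
  induction α using WellFoundedLT.induction with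
  | _ α ih =>
  intro A
  constructor
  · intro h
    cases h with
    | base _ h =>
      obtain ⟨f, hf, hI, rfl⟩ := h
      refine FunMul.base _ ⟨f, hf, hI, ?_⟩
      ext x
      have := hI x
      simp only [mem_compl_iff, mem_preimage, mem_Ioc, mem_singleton_iff, mem_Icc] at *
      constructor
      · intro h
        by_contra h'
        exact h ⟨lt_of_le_of_ne this.1 (Ne.symm h'), this.2⟩
      · intro h h'
        linarith [h'.1]
    | union _ hα β hβ s hs =>
      rw [compl_iUnion]
      exact FunMul.inter _ hα β hβ _ fun n => (ih _ (hβ n) _).2 (hs n)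
  · intro h
    cases h with
    | base _ h =>
      obtain ⟨f, hf, hI, rfl⟩ := h
      refine FunAdd.base _ ⟨f, hf, hI, ?_⟩
      ext x
      have := hI x
      simp only [mem_compl_iff, mem_preimage, mem_Ioc, mem_singleton_iff, mem_Icc] at *
      constructor
      · intro h
        exact ⟨lt_of_le_of_ne this.1 (Ne.symm h), this.2⟩
      · intro h h'
        linarith [h.1]
    | inter _ hα β hβ s hs =>
      rw [compl_iInter]
      exact FunAdd.union _ hα β hβ _ fun n => (ih _ (hβ n) _).1 (hs n)

theorem h3_add_mono {β α : Ordinal.{0}} (h : β ≤ α) {A : Set X} (hA : FunAdd X β A) :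
    FunAdd X α A := by
  rcases h.eq_or_lt with rfl | h
  · exact hA
  have hα : α ≠ 0 := (lt_of_le_of_lt (zero_le) h).ne'
  cases hA with
  | base _ hA =>
    obtain ⟨f, hf, hI, rfl⟩ := hA
    have : f ⁻¹' Ioc 0 1 = ⋃ n : ℕ, {x | 1 / ((n : ℝ) + 1) ≤ f x} := by
      ext x
      have := hI x
      simp only [mem_preimage, mem_Ioc, mem_iUnion, mem_ofPred_eq, mem_Icc] at *
      constructor
      · intro h
        obtain ⟨n, hn⟩ := exists_nat_one_div_lt h.1
        exact ⟨n, hn.le⟩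
      · rintro ⟨n, hn⟩
        exact ⟨lt_of_lt_of_le (by positivity) hn, this.2⟩
    rw [this]
    refine FunAdd.union _ hα (fun _ => 0) (fun _ => h) _ fun n => FunMul.base _ ?_
    have h0 : (0 : ℝ) < 1 / ((n : ℝ) + 1) := by positivity
    have h1 : 1 / ((n : ℝ) + 1) ≤ 1 := by
      rw [div_le_one (by positivity)]
      have : (0 : ℝ) ≤ n := by positivity
      linarith
    refine ⟨fun x => max 0 (1 / ((n : ℝ) + 1) - f x), by fun_prop, ?_, ?_⟩
    · intro x
      have := (hI x).1
      exact ⟨le_max_left _ _, max_le zero_le_one (by linarith)⟩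
    · ext x
      simp only [mem_ofPred_eq, mem_preimage, mem_singleton_iff, max_eq_left_iff, sub_nonpos]
  | union _ hβ γ hγ s hs =>
    exact FunAdd.union _ hα γ (fun n => (hγ n).trans h) s hs

theorem h3_mul_mono {β α : Ordinal.{0}} (h : β ≤ α) {A : Set X} (hA : FunMul X β A) :
    FunMul X α A := by
  have := (h3_compl α _).1 (h3_add_mono h ((h3_compl β A).2 hA))
  rwa [compl_compl] at this

theorem h3_add_univ (α : Ordinal.{0}) : FunAdd X α univ :=
  h3_add_mono (zero_le) (FunAdd.base _ ⟨fun _ => 1, continuous_const, by simp, by simp⟩)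

theorem h3_add_empty (α : Ordinal.{0}) : FunAdd X α ∅ :=
  h3_add_mono (zero_le) (FunAdd.base _ ⟨fun _ => 0, continuous_const, by simp, by simp⟩)

theorem h3_add_iUnion {α : Ordinal.{0}} (hα : α ≠ 0) (s : ℕ → Set X)
    (hs : ∀ n, FunAdd X α (s n)) : FunAdd X α (⋃ n, s n) := by
  have : ∀ n, ∃ (β : ℕ → Ordinal.{0}) (t : ℕ → Set X), (∀ m, β m < α) ∧
      (∀ m, FunMul X (β m) (t m)) ∧ s n = ⋃ m, t m := by
    intro n
    have := hs n
    generalize s n = S at this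
    cases this with
    | base => exact absurd rfl hα
    | union _ _ β hβ t ht => exact ⟨β, t, hβ, ht, rfl⟩
  choose β t hβ ht he using this
  have e : (⋃ n, s n) = ⋃ k : ℕ, t k.unpair.1 k.unpair.2 := by
    simp only [he]
    ext x
    simp only [mem_iUnion]
    constructor
    · rintro ⟨n, m, h⟩
      exact ⟨Nat.pair n m, by simpa using h⟩
    · rintro ⟨k, h⟩
      exact ⟨_, _, h⟩
  rw [e]
  exact FunAdd.union _ hα _ (fun k => hβ k.unpair.1 k.unpair.2) _ fun k => ht _ _

theorem h3_add_union {α : Ordinal.{0}} (hα : α ≠ 0) {A B : Set X} (hA : FunAdd X α A)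
    (hB : FunAdd X α B) : FunAdd X α (A ∪ B) := by
  have : A ∪ B = ⋃ n : ℕ, if n = 0 then A else B := by
    ext x
    simp only [mem_union, mem_iUnion]
    constructor
    · rintro (h | h)
      · exact ⟨0, by simpa using h⟩
      · exact ⟨1, by simpa using h⟩
    · rintro ⟨n, h⟩
      split_ifs at h
      · exact Or.inl h
      · exact Or.inr h
  rw [this]
  refine h3_add_iUnion hα _ fun n => ?_
  split_ifs
  · exact hA
  · exact hB

theorem h3_mul_inter {α : Ordinal.{0}} {A B : Set X} (hA : FunMul X α A)
    (hB : FunMul X α B) : FunMul X α (A ∩ B) := by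
  by_cases hα : α = 0
  · subst hα
    cases hA with
    | inter _ h => exact absurd rfl h
    | base _ hA =>
    cases hB with
    | inter _ h => exact absurd rfl h
    | base _ hB =>
    obtain ⟨f, hf, hI, rfl⟩ := hA
    obtain ⟨g, hg, hJ, rfl⟩ := hB
    refine FunMul.base _ ⟨fun x => max (f x) (g x), by fun_prop, fun x =>
      ⟨(hI x).1.trans (le_max_left _ _), max_le (hI x).2 (hJ x).2⟩, ?_⟩
    ext x
    have h1 := (hI x).1
    have h2 := (hJ x).1
    simp only [mem_inter_iff, mem_preimage, mem_singleton_iff]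
    constructor
    · rintro ⟨h, h'⟩
      simp [h, h']
    · intro h
      exact ⟨le_antisymm (h ▸ le_max_left _ _) h1, le_antisymm (h ▸ le_max_right _ _) h2⟩
  · have := (h3_compl α _).1 (h3_add_union hα ((h3_compl α A).2 hA) ((h3_compl α B).2 hB))
    rwa [compl_union, compl_compl, compl_compl] at this

theorem h3_add_inter {α : Ordinal.{0}} (hα : α ≠ 0) {A B : Set X} (hA : FunAdd X α A)
    (hB : FunAdd X α B) : FunAdd X α (A ∩ B) := by
  cases hA with
  | base => exact absurd rfl hα
  | union _ _ β hβ s hs =>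
  cases hB with
  | base => exact absurd rfl hα
  | union _ _ γ hγ t ht =>
  rw [iUnion_inter]
  refine h3_add_iUnion hα _ fun n => ?_
  rw [inter_iUnion]
  exact FunAdd.union _ hα (fun m => max (β n) (γ m)) (fun m => max_lt (hβ n) (hγ m)) _ fun m =>
    h3_mul_inter (h3_mul_mono (le_max_left _ _) (hs n)) (h3_mul_mono (le_max_right _ _) (ht m))

theorem h3_mul_add {β α : Ordinal.{0}} (h : β < α) {A : Set X} (hA : FunMul X β A) :
    FunAdd X α A := by
  have := FunAdd.union α (lt_of_le_of_lt (zero_le) h).ne' (fun _ => β) (fun _ => h)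
    (fun _ => A) (fun _ => hA)
  rwa [iUnion_const] at this

theorem h3_add_biInter {α : Ordinal.{0}} (hα : α ≠ 0) (s : ℕ → Set X)
    (hs : ∀ n, FunAdd X α (s n)) (n : ℕ) : FunAdd X α {x | ∀ k < n, x ∈ s k} := by
  induction n with
  | zero => simpa using h3_add_univ α
  | succ n ih =>
    have : {x | ∀ k < n + 1, x ∈ s k} = {x | ∀ k < n, x ∈ s k} ∩ s n := by
      ext x
      simp only [mem_ofPred_eq, mem_inter_iff, Nat.forall_lt_succ_right]
    rw [this]
    exact h3_add_inter hα ih (hs n)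

theorem h3_sep {α : Ordinal.{0}} (hα : α ≠ 0) {A B : Set X} (hA : FunMul X α A)
    (hB : FunMul X α B) (hAB : Disjoint A B) :
    ∃ C : Set X, FunAdd X α C ∧ FunAdd X α Cᶜ ∧ A ⊆ C ∧ B ⊆ Cᶜ := by
  cases hA with
  | base => exact absurd rfl hα
  | inter _ _ β hβ s hs =>
  cases hB with
  | base => exact absurd rfl hα
  | inter _ _ γ hγ t ht =>
  -- complements of `s n` and `t n` cover
  have hcov : ∀ x, (∃ n, x ∉ s n) ∨ ∃ n, x ∉ t n := by
    intro x
    by_contra h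
    push Not at h
    exact disjoint_left.1 hAB (mem_iInter.2 h.1) (mem_iInter.2 h.2)
  have hs' : ∀ n, FunAdd X α (s n) := fun n => h3_add_mono (hβ n).le (hs n)
  have ht' : ∀ n, FunAdd X α (t n) := fun n => h3_add_mono (hγ n).le (ht n)
  have hsc : ∀ n, FunAdd X α (s n)ᶜ := fun n => h3_mul_add (hβ n) ((h3_compl _ _).1 (hs n))
  have htc : ∀ n, FunAdd X α (t n)ᶜ := fun n => h3_mul_add (hγ n) ((h3_compl _ _).1 (ht n))
  have hC : FunAdd X α (⋃ n, (t n)ᶜ ∩ {x | ∀ k < n, x ∈ s k}) :=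
    h3_add_iUnion hα _ fun n => h3_add_inter hα (htc n) (h3_add_biInter hα s hs' n)
  have hD : FunAdd X α (⋃ n, (s n)ᶜ ∩ {x | ∀ k < n + 1, x ∈ t k}) :=
    h3_add_iUnion hα _ fun n => h3_add_inter hα (hsc n) (h3_add_biInter hα t ht' (n + 1))
  have hDC : (⋃ n, (t n)ᶜ ∩ {x | ∀ k < n, x ∈ s k})ᶜ =
      ⋃ n, (s n)ᶜ ∩ {x | ∀ k < n + 1, x ∈ t k} := by
    classical
    ext x
    simp only [mem_compl_iff, mem_iUnion, mem_inter_iff, mem_ofPred_eq]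
    constructor
    · intro h
      by_cases hx : ∃ n, x ∉ s n
      · refine ⟨Nat.find hx, Nat.find_spec hx, fun k hk => ?_⟩
        by_contra hkt
        refine h ⟨k, hkt, fun j hj => ?_⟩
        by_contra hjs
        have := Nat.find_min' hx hjs
        omega
      · obtain ⟨n, hn⟩ := (hcov x).resolve_left hx
        push Not at hx
        exact absurd ⟨n, hn, fun k _ => hx k⟩ h
    · rintro ⟨n, hn, h⟩ ⟨m, hm, h'⟩
      by_cases hmn : m < n + 1
      · exact hm (h m hmn)
      · exact hn (h' n (by omega))
  refine ⟨_, hC, hDC ▸ hD, ?_, ?_⟩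
  · rw [← compl_subset_compl, hDC]
    intro x hx hx'
    obtain ⟨n, hn⟩ := mem_iUnion.1 hx
    exact hn.1 (mem_iInter.1 hx' n)
  · intro x hx hx'
    obtain ⟨n, hn⟩ := mem_iUnion.1 hx'
    exact hn.1 (mem_iInter.1 hx n)

end helpers

/-- any two disjoint sets of the `α`'th functionally multiplicative class
are `α`-separated. -/
theorem stmt3 {X : Type u} [TopologicalSpace X] (α : Ordinal.{0}) (hα : α < omega1)
    (A B : Set X) (hA : FunMul X α A) (hB : FunMul X α B) (hAB : Disjoint A B) :
    AlphaSeparated α A B := by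
  classical
  by_cases h0 : α = 0
  · subst h0
    cases hA with
    | inter _ h => exact absurd rfl h
    | base _ hA =>
    cases hB with
    | inter _ h => exact absurd rfl h
    | base _ hB =>
    obtain ⟨f, hf, hI, rfl⟩ := hA
    obtain ⟨g, hg, hJ, rfl⟩ := hB
    have hne : ∀ x, f x + g x ≠ 0 := by
      intro x hx
      have h1 := (hI x).1
      have h2 := (hJ x).1
      have h3 : f x = 0 := by linarith
      have h4 : g x = 0 := by linarith
      exact (disjoint_left.1 hAB : ∀ ⦃a⦄, _ → _) (show x ∈ f ⁻¹' {0} from h3) (show x ∈ g ⁻¹' {0} from h4)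
    refine ⟨fun x => f x / (f x + g x), ⟨fun _ => hf.div (hf.add hg) hne,
      fun h => absurd rfl h⟩, ?_, ?_⟩
    · intro x hx
      have hx : f x = 0 := hx
      simp [hx]
    · intro x hx
      have hx : g x = 0 := hx
      have := hne x
      rw [hx, add_zero] at this
      simp [hx, this]
  · obtain ⟨C, hC, hC', hAC, hBC⟩ := h3_sep h0 hA hB hAB
    refine ⟨fun x => if x ∈ C then 0 else 1, ⟨fun h => absurd h h0, fun _ V _ => ?_⟩, ?_, ?_⟩
    · have : ((fun x => if x ∈ C then (0 : ℝ) else 1) ⁻¹' V) =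
          (if (0 : ℝ) ∈ V then C else ∅) ∪ (if (1 : ℝ) ∈ V then Cᶜ else ∅) := by
        ext x
        by_cases hx : x ∈ C <;> by_cases h1 : (0 : ℝ) ∈ V <;> by_cases h2 : (1 : ℝ) ∈ V <;>
          simp [hx, h1, h2]
      rw [this]
      refine h3_add_union h0 ?_ ?_
      · split_ifs
        · exact hC
        · exact h3_add_empty α
      · split_ifs
        · exact hC'
        · exact h3_add_empty α
    · intro x hx
      simp [hAC hx]
    · intro x hx
      have := hBC hx
      simp only [mem_compl_iff] at this
      simp [this]
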